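/- Let X be a second-countable locally compact Hausdorff space and let κ be a kernel on X satisfying (R1), (R2), (R3). Let A ⊂ X, A ≠ X, with cp_*A > 0, and let ω be a nonzero positive Radon measure with either I(ω) < ∞, or ω concentrated on X∖A and ω(X) < ∞. Then, as K ranges over the compact subsets of A directed upwards by inclusion, the inner balayages ω^K converge to ω^A strongly in E'(A), converge to ω^A vaguely, and their potentials U^{ω^K} increase pointwise on X to U^{ω^A}; moreover, each of these three limit relations uniquely determines ω^A within E'(A). Here ω^K denotes the unique measure in E⁺(K) with U^{ω^K} = U^ω nearly everywhere on K. -/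

import Mathlib

open MeasureTheory Filter Set Topology ENNReal CompactlySupported UniformConvergence

namespace Balayage
open scoped Classical

variable {X : Type*} [TopologicalSpace X] [MeasurableSpace X]

/-- A kernel: symmetric, lower semicontinuous, `[0,∞]`-valued. -/
structure IsKernel (κ : X → X → ℝ≥0∞) : Prop where
  symm : ∀ x y, κ x y = κ y x
  lsc : LowerSemicontinuous fun p : X × X => κ p.1 p.2

/-- The potential `U^μ(x) = ∫ κ(x,y) dμ(y)`. -/
noncomputable def potential (κ : X → X → ℝ≥0∞) (μ : Measure X) (x : X) : ℝ≥0∞ :=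
  ∫⁻ y, κ x y ∂μ

/-- The mutual energy `I(μ,ν) = ∫∫ κ(x,y) dν(y) dμ(x)` of two positive measures. -/
noncomputable def energy (κ : X → X → ℝ≥0∞) (μ ν : Measure X) : ℝ≥0∞ :=
  ∫⁻ x, potential κ ν x ∂μ

/-- A positive Radon measure (regular Borel measure, finite on compacts). -/
def IsRadon (μ : Measure X) : Prop := μ.Regular

/-- Finite energy: `I(μ) < ∞`. -/
def FiniteEnergy (κ : X → X → ℝ≥0∞) (μ : Measure X) : Prop := energy κ μ μ < ⊤

/-- Membership in the cone `E⁺` of positive Radon measures of finite energy. -/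
def memE (κ : X → X → ℝ≥0∞) (μ : Measure X) : Prop := IsRadon μ ∧ FiniteEnergy κ μ

/-- Membership in `E⁺(A)`: measures of `E⁺` concentrated on `A`
(i.e. the complement of `A` is negligible). -/
def memEOn (κ : X → X → ℝ≥0∞) (A : Set X) (μ : Measure X) : Prop :=
  memE κ μ ∧ μ Aᶜ = 0

/-- The strong (energy) distance `‖μ-ν‖ = √(I(μ)+I(ν)-2I(μ,ν))`. -/
noncomputable def sDist (κ : X → X → ℝ≥0∞) (μ ν : Measure X) : ℝ :=
  Real.sqrt ((energy κ μ μ).toReal + (energy κ ν ν).toReal - 2 * (energy κ μ ν).toReal)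

/-- Membership in `E'(A)`, the strong closure of `E⁺(A)` in `E⁺`. -/
def memEClos (κ : X → X → ℝ≥0∞) (A : Set X) (μ : Measure X) : Prop :=
  memE κ μ ∧ ∀ ε : ℝ, 0 < ε → ∃ ν, memEOn κ A ν ∧ sDist κ μ ν < ε

/-- The capacity of a compact set: the inverse of the minimal energy of
probability measures concentrated on it. -/
noncomputable def capC (κ : X → X → ℝ≥0∞) (K : Set X) : ℝ≥0∞ :=
  (⨅ (μ : Measure X) (_ : IsProbabilityMeasure μ) (_ : μ Kᶜ = 0), energy κ μ μ)⁻¹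

/-- The inner capacity `cp_* A`: supremum of capacities of compact subsets. -/
noncomputable def innerCap (κ : X → X → ℝ≥0∞) (A : Set X) : ℝ≥0∞ :=
  ⨆ (K : Set X) (_ : IsCompact K) (_ : K ⊆ A), capC κ K

/-- The outer capacity `cp^* A`: infimum of inner capacities of open supersets. -/
noncomputable def outerCap (κ : X → X → ℝ≥0∞) (A : Set X) : ℝ≥0∞ :=
  ⨅ (D : Set X) (_ : IsOpen D) (_ : A ⊆ D), innerCap κ D

/-- Strict positive definiteness (energy principle), stated for pairs of positive
measures of finite energy: `I(μ-ν) ≥ 0`, with equality only for `μ = ν`. -/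
def StrictlyPosDef (κ : X → X → ℝ≥0∞) : Prop :=
  ∀ μ ν : Measure X, IsRadon μ → IsRadon ν → FiniteEnergy κ μ → FiniteEnergy κ ν →
    (2 * energy κ μ ν ≤ energy κ μ μ + energy κ ν ν) ∧
    (2 * energy κ μ ν = energy κ μ μ + energy κ ν ν → μ = ν)

/-- Vague convergence of a sequence of measures: convergence of integrals of
continuous compactly supported functions. -/
def VagueTendsto (μ : ℕ → Measure X) (μ₀ : Measure X) : Prop :=
  ∀ f : X → ℝ, Continuous f → HasCompactSupport f →
    Tendsto (fun j => ∫ x, f x ∂(μ j)) atTop (nhds (∫ x, f x ∂μ₀))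

/-- A perfect kernel: strictly positive definite, `E⁺` strongly complete, and the strong
topology on `E⁺` finer than the vague topology (sequential formulation; sequences suffice
on second-countable spaces). -/
structure Perfect (κ : X → X → ℝ≥0∞) : Prop where
  posdef : StrictlyPosDef κ
  complete : ∀ μ : ℕ → Measure X, (∀ j, memE κ (μ j)) →
    (∀ ε : ℝ, 0 < ε → ∃ N, ∀ m ≥ N, ∀ n ≥ N, sDist κ (μ m) (μ n) < ε) →
    ∃ μ₀, memE κ μ₀ ∧ Tendsto (fun j => sDist κ (μ j) μ₀) atTop (nhds 0)
  finerThanVague : ∀ (μ : ℕ → Measure X) (μ₀ : Measure X), (∀ j, memE κ (μ j)) →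
    memE κ μ₀ → Tendsto (fun j => sDist κ (μ j) μ₀) atTop (nhds 0) → VagueTendsto μ μ₀

/-- The domination principle. -/
def Domination (κ : X → X → ℝ≥0∞) : Prop :=
  ∀ μ ν : Measure X, memE κ μ → IsRadon ν →
    (∀ᵐ x ∂μ, potential κ μ x ≤ potential κ ν x) → ∀ x, potential κ μ x ≤ potential κ ν x

/-- `h`-Ugaheri's maximum principle; for `h = 1` this is Frostman's maximum principle. -/
def Ugaheri (κ : X → X → ℝ≥0∞) (h : ℝ) : Prop :=
  ∀ μ : Measure X, memE κ μ → ∀ c : ℝ, 0 < c →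
    (∀ᵐ x ∂μ, potential κ μ x ≤ ENNReal.ofReal c) →
    ∀ x, potential κ μ x ≤ ENNReal.ofReal (h * c)

/-- Condition (R1): the kernel is perfect and satisfies the domination and
`h`-Ugaheri maximum principles for some `h ∈ [1, ∞)`. -/
structure R1 (κ : X → X → ℝ≥0∞) : Prop where
  perfect : Perfect κ
  domination : Domination κ
  ugaheri : ∃ h : ℝ, 1 ≤ h ∧ Ugaheri κ h

/-- Condition (R2): `κ(x,y)` is continuous and finite off the diagonal. -/
def R2 (κ : X → X → ℝ≥0∞) : Prop :=
  ContinuousOn (fun p : X × X => κ p.1 p.2) {p : X × X | p.1 ≠ p.2} ∧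
    ∀ x y : X, x ≠ y → κ x y ≠ ⊤

/-- Condition (R3): `κ(·,y) → 0` uniformly on compact sets as `y` tends to the
Alexandroff point of `X`. -/
def R3 (κ : X → X → ℝ≥0∞) : Prop :=
  ∀ K : Set X, IsCompact K → ∀ ε : ℝ≥0∞, 0 < ε →
    ∃ K' : Set X, IsCompact K' ∧ ∀ y ∉ K', ∀ x ∈ K, κ x y < ε

/-- `μA` is the inner balayage of `ω` onto `A`: it belongs to `E'(A)` and its potential
coincides with that of `ω` nearly everywhere on `A` (up to a set of inner capacity zero). -/
def IsInnerBalayage (κ : X → X → ℝ≥0∞) (A : Set X) (ω μA : Measure X) : Prop :=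
  memEClos κ A μA ∧ innerCap κ {x ∈ A | potential κ μA x ≠ potential κ ω x} = 0

/-- `μA` is the outer balayage of `ω` onto `A`: it belongs to `E'(A)` and its potential
coincides with that of `ω` quasi-everywhere on `A` (up to a set of outer capacity zero). -/
def IsOuterBalayage (κ : X → X → ℝ≥0∞) (A : Set X) (ω μA : Measure X) : Prop :=
  memEClos κ A μA ∧ outerCap κ {x ∈ A | potential κ μA x ≠ potential κ ω x} = 0

/-- Membership in the class `Γ_{A,ω}` of positive finite-energy Radon measures whose
potential dominates that of `ω` nearly everywhere on `A`. -/
def memGamma (κ : X → X → ℝ≥0∞) (A : Set X) (ω ν : Measure X) : Prop :=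
  memE κ ν ∧ innerCap κ {x ∈ A | ¬ potential κ ω x ≤ potential κ ν x} = 0


section Helpers

variable {X : Type*} [TopologicalSpace X] [T2Space X] [LocallyCompactSpace X]
    [SecondCountableTopology X] [MeasurableSpace X] [BorelSpace X]
variable {κ : X → X → ℝ≥0∞}

lemma kernel_measurable (hκ : IsKernel κ) : Measurable fun p : X × X => κ p.1 p.2 :=
  hκ.lsc.measurable

lemma potential_measurable (hκ : IsKernel κ) {μ : Measure X} (hμ : IsRadon μ) :
    Measurable (potential κ μ) := by
  have : μ.Regular := hμ
  exact (kernel_measurable hκ).lintegral_prod_right'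

lemma energy_comm (hκ : IsKernel κ) {μ ν : Measure X} (hμ : IsRadon μ) (hν : IsRadon ν) :
    energy κ μ ν = energy κ ν μ := by
  have : μ.Regular := hμ
  have : ν.Regular := hν
  unfold energy potential
  rw [lintegral_lintegral_swap (kernel_measurable hκ).aemeasurable]
  simp_rw [hκ.symm]

lemma energy_ne_top (hR1 : R1 κ) {μ ν : Measure X} (hμ : memE κ μ) (hν : memE κ ν) :
    energy κ μ ν ≠ ⊤ := by
  have h := (hR1.perfect.posdef μ ν hμ.1 hν.1 hμ.2 hν.2).1
  have h2 : energy κ μ μ + energy κ ν ν < ⊤ := ENNReal.add_lt_top.2 ⟨hμ.2, hν.2⟩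
  have h3 := h.trans_lt h2
  intro h4
  rw [h4] at h3
  simp at h3

lemma restrict_mono_energy (μ ν : Measure X) (K : Set X) (h : ν ≤ μ) :
    energy κ ν ν ≤ energy κ μ μ := by
  unfold energy
  exact lintegral_mono' h fun x => lintegral_mono' h le_rfl

lemma restrict_memE {μ : Measure X} (hμ : memE κ μ) (K : Set X) : memE κ (μ.restrict K) := by
  have : μ.Regular := hμ.1
  refine ⟨?_, (restrict_mono_energy μ _ K Measure.restrict_le_self).trans_lt hμ.2⟩
  have : (μ.restrict K).Regular := inferInstance
  exact this

lemma null_of_innerCap {μ : Measure X} (hμ : memE κ μ) {S : Set X} (hS : MeasurableSet S)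
    (hc : innerCap κ S = 0) : μ S = 0 := by
  have : μ.Regular := hμ.1
  by_contra h0
  obtain ⟨K, hKS, hK, hpos⟩ := hS.exists_lt_isCompact (μ := μ) (pos_iff_ne_zero.2 h0)
  have hKfin : μ K ≠ ⊤ := hK.measure_lt_top.ne
  have hcap : capC κ K = 0 := by
    apply le_antisymm _ zero_le
    rw [← hc]
    exact le_iSup_of_le K (le_iSup_of_le hK (le_iSup_of_le hKS le_rfl))
  unfold capC at hcap
  rw [ENNReal.inv_eq_zero] at hcap
  simp only [iInf_eq_top] at hcap
  have hp : IsProbabilityMeasure ((μ K)⁻¹ • μ.restrict K) := by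
    constructor
    simp [ENNReal.inv_mul_cancel hpos.ne' hKfin]
  have h := hcap ((μ K)⁻¹ • μ.restrict K) hp (by simp [hK.measurableSet])
  have hinv : (μ K)⁻¹ ≠ ⊤ := by simpa using hpos.ne'
  have he : energy κ ((μ K)⁻¹ • μ.restrict K) ((μ K)⁻¹ • μ.restrict K)
      = (μ K)⁻¹ * ((μ K)⁻¹ * energy κ (μ.restrict K) (μ.restrict K)) := by
    unfold energy potential
    simp only [lintegral_smul_measure, smul_eq_mul]
    rw [lintegral_const_mul' _ _ hinv]
  rw [he] at h
  exact ENNReal.mul_ne_top hinv (ENNReal.mul_ne_top hinv (restrict_memE hμ K).2.ne) h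

/-- If potentials of `α` and `ω` agree n.e. on `A`, they agree a.e. for every measure of finite
energy on a compact subset of `A`. -/
lemma ae_eq_of_ne (hκ : IsKernel κ) {A K : Set X} (hK : IsCompact K) (hKA : K ⊆ A)
    {α ω ν : Measure X} (hα : IsRadon α) (hω : IsRadon ω) (hν : memEOn κ K ν)
    (hc : innerCap κ {x ∈ A | potential κ α x ≠ potential κ ω x} = 0) :
    ∀ᵐ x ∂ν, potential κ α x = potential κ ω x := by
  have hm : MeasurableSet {x ∈ K | potential κ α x ≠ potential κ ω x} :=
    hK.measurableSet.inter
      (measurableSet_eq_fun (potential_measurable hκ hα) (potential_measurable hκ hω)).compl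
  have hz : innerCap κ {x ∈ K | potential κ α x ≠ potential κ ω x} = 0 := by
    apply le_antisymm _ zero_le
    rw [← hc]
    unfold innerCap
    refine iSup_mono fun C => iSup_mono fun hC => iSup_le fun hCS => ?_
    exact le_iSup_of_le (hCS.trans fun x hx => ⟨hKA hx.1, hx.2⟩) le_rfl
  have h1 := null_of_innerCap hν.1 hm hz
  have h2 := hν.2
  rw [ae_iff]
  refine measure_mono_null (t := {x ∈ K | potential κ α x ≠ potential κ ω x} ∪ Kᶜ) ?_
    (measure_union_null h1 h2)
  intro x hx
  by_cases hxK : x ∈ K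
  · exact Or.inl ⟨hxK, hx⟩
  · exact Or.inr hxK

lemma exists_compact_approx (hκ : IsKernel κ) (hR1 : R1 κ) {A : Set X} {α ν : Measure X}
    (hα : memE κ α) (hν : memEOn κ A ν) {δ : ℝ} (hδ : 0 < δ) :
    ∃ K, IsCompact K ∧ K ⊆ A ∧
      (energy κ ν α).toReal - δ < (energy κ (ν.restrict K) α).toReal := by
  by_cases hzero : energy κ ν α = 0
  · refine ⟨∅, isCompact_empty, empty_subset _, ?_⟩
    rw [hzero]
    have : 0 ≤ (energy κ (ν.restrict ∅) α).toReal := ENNReal.toReal_nonneg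
    simp only [ENNReal.toReal_zero]
    linarith
  have hfin := energy_ne_top hR1 hν.1 hα
  set m := ν.withDensity (potential κ α) with hm
  have hmuniv : m univ = energy κ ν α := by
    rw [hm, withDensity_apply _ MeasurableSet.univ, Measure.restrict_univ]; rfl
  have : IsFiniteMeasure m := ⟨by rw [hmuniv]; exact hfin.lt_top⟩
  have hmA : m Aᶜ = 0 := withDensity_absolutelyContinuous _ _ hν.2
  set B := (toMeasurable m Aᶜ)ᶜ with hB
  have hBm : MeasurableSet B := (measurableSet_toMeasurable _ _).compl
  have hBA : B ⊆ A := by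
    rw [hB, compl_subset_comm]; exact subset_toMeasurable _ _
  have hmB : m B = m univ := by
    have h : m (Bᶜ) = 0 := by rw [hB, compl_compl, measure_toMeasurable, hmA]
    rw [← measure_add_measure_compl hBm, h, add_zero]
  have hlt : m B - ENNReal.ofReal δ < m B := by
    apply ENNReal.sub_lt_self (by rw [hmB, hmuniv]; exact hfin)
      (by rw [hmB, hmuniv]; exact hzero)
    simpa using hδ
  obtain ⟨K, hKB, hK, hKlt⟩ := hBm.exists_lt_isCompact (μ := m) hlt
  refine ⟨K, hK, hKB.trans hBA, ?_⟩
  have hmK : m K = energy κ (ν.restrict K) α := by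
    rw [hm, withDensity_apply _ hK.measurableSet]; rfl
  rw [hmB, hmuniv, hmK] at hKlt
  have hKfin := energy_ne_top hR1 (restrict_memE hν.1 K) hα
  have h3 : energy κ ν α < energy κ (ν.restrict K) α + ENNReal.ofReal δ := by
    by_contra hcon
    push Not at hcon
    exact absurd hKlt (not_lt.2 (ENNReal.le_sub_of_add_le_right ENNReal.ofReal_ne_top hcon))
  have h4 := ENNReal.toReal_strict_mono
    (ENNReal.add_ne_top.2 ⟨hKfin, ENNReal.ofReal_ne_top⟩) h3
  rw [ENNReal.toReal_add hKfin ENNReal.ofReal_ne_top, ENNReal.toReal_ofReal hδ.le] at h4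
  linarith

lemma open_le_liminf {μ : ℕ → Measure X} {μ₀ : Measure X} (hμ : ∀ n, IsRadon (μ n))
    (hμ₀ : IsRadon μ₀) (hv : VagueTendsto μ μ₀) (G : Set X) (hG : IsOpen G) :
    μ₀ G ≤ atTop.liminf (fun i => μ i G) := by
  have : μ₀.Regular := hμ₀
  have : ∀ n, (μ n).Regular := hμ
  refine le_of_forall_lt fun c hc => ?_
  obtain ⟨K, hKG, hK, hcK⟩ := hG.exists_lt_isCompact hc
  obtain ⟨f, hf1, hf0, hfc, hf⟩ := exists_continuous_one_zero_of_isCompact hK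
    hG.isClosed_compl (disjoint_compl_right_iff_subset.2 hKG)
  have key : ∀ m : Measure X, m.Regular →
      ∫⁻ x, ENNReal.ofReal (f x) ∂m = ENNReal.ofReal (∫ x, f x ∂m) := by
    intro m hm
    rw [ofReal_integral_eq_lintegral_ofReal (f.continuous.integrable_of_hasCompactSupport hfc)
      (Eventually.of_forall fun x => (hf x).1)]
  have hlim : Tendsto (fun n => ∫⁻ x, ENNReal.ofReal (f x) ∂(μ n)) atTop
      (𝓝 (∫⁻ x, ENNReal.ofReal (f x) ∂μ₀)) := by
    rw [key μ₀ hμ₀]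
    simp_rw [fun n => key (μ n) (hμ n)]
    exact ENNReal.tendsto_ofReal (hv f f.continuous hfc)
  have hle : ∀ n, ∫⁻ x, ENNReal.ofReal (f x) ∂(μ n) ≤ μ n G := by
    intro n
    rw [← lintegral_indicator_one hG.measurableSet]
    refine lintegral_mono fun x => ?_
    by_cases hx : x ∈ G
    · simp [hx, (hf x).2]
    · have : f x = 0 := hf0 hx
      simp [hx, this]
  have hge : μ₀ K ≤ ∫⁻ x, ENNReal.ofReal (f x) ∂μ₀ := by
    rw [← lintegral_indicator_one hK.measurableSet]
    refine lintegral_mono fun x => ?_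
    by_cases hx : x ∈ K
    · have : f x = 1 := hf1 hx
      simp [hx, this]
    · simp [hx]
  calc c < μ₀ K := hcK
    _ ≤ _ := hge
    _ = atTop.liminf (fun n => ∫⁻ x, ENNReal.ofReal (f x) ∂(μ n)) := hlim.liminf_eq.symm
    _ ≤ _ := liminf_le_liminf (Eventually.of_forall hle)

lemma lintegral_lsc_le_of_vague {μ : ℕ → Measure X} {μ₀ : Measure X} (hμ : ∀ n, IsRadon (μ n))
    (hμ₀ : IsRadon μ₀) (hv : VagueTendsto μ μ₀) {g : X → ℝ≥0∞} (hg : LowerSemicontinuous g)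
    {c : ℝ≥0∞} (hc : ∀ n, ∫⁻ x, g x ∂(μ n) ≤ c) : ∫⁻ x, g x ∂μ₀ ≤ c := by
  have hgm : Measurable g := hg.measurable
  have hsup : ∀ x, g x = ⨆ N : ℕ, min (g x) N := by
    intro x
    apply le_antisymm
    · refine le_of_forall_lt fun a ha => ?_
      obtain ⟨N, hN⟩ := ENNReal.exists_nat_gt (ne_top_of_lt ha)
      exact lt_of_lt_of_le (lt_min ha hN) (le_iSup (fun N : ℕ => min (g x) (N : ℝ≥0∞)) N)
    · exact iSup_le fun N => min_le_left _ _
  rw [lintegral_congr hsup, lintegral_iSup (fun N => hgm.min measurable_const)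
    (fun a b hab x => min_le_min_left _ (by exact_mod_cast hab))]
  refine iSup_le fun N => ?_
  set f : X → ℝ := fun x => (min (g x) N).toReal with hf
  have hne : ∀ x, min (g x) (N : ℝ≥0∞) ≠ ⊤ := fun x =>
    ne_top_of_le_ne_top (ENNReal.natCast_ne_top N) (min_le_right _ _)
  have hfe : ∀ x, min (g x) (N : ℝ≥0∞) = ENNReal.ofReal (f x) := fun x =>
    (ENNReal.ofReal_toReal (hne x)).symm
  have hfm : Measurable f := (hgm.min measurable_const).ennreal_toReal
  have hfnn : ∀ x, 0 ≤ f x := fun x => ENNReal.toReal_nonneg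
  have hopen : ∀ t ∈ Ioi (0:ℝ), IsOpen {x | t < f x} := by
    intro t ht
    have : {x | t < f x} = if ENNReal.ofReal t < N then {x | ENNReal.ofReal t < g x} else ∅ := by
      ext x
      have : t < f x ↔ ENNReal.ofReal t < min (g x) N :=
        (ENNReal.ofReal_lt_iff_lt_toReal (le_of_lt ht) (hne x)).symm
      rw [mem_setOf_eq, this, lt_min_iff]
      split_ifs with h <;> simp [h]
    rw [this]
    split_ifs
    · exact hg.isOpen_preimage _
    · exact isOpen_empty
  have hbd : ∀ n, ∫⁻ t in Ioi 0, (μ n) {x | t < f x} ≤ c := by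
    intro n
    rw [← lintegral_eq_lintegral_meas_lt _ (Eventually.of_forall hfnn) hfm.aemeasurable]
    refine le_trans (lintegral_mono fun x => ?_) (hc n)
    rw [← hfe]
    exact min_le_left _ _
  simp_rw [hfe]
  rw [lintegral_eq_lintegral_meas_lt _ (Eventually.of_forall hfnn) hfm.aemeasurable]
  calc ∫⁻ t in Ioi 0, μ₀ {x | t < f x}
      ≤ ∫⁻ t in Ioi 0, atTop.liminf (fun n => μ n {x | t < f x}) :=
        setLIntegral_mono' measurableSet_Ioi fun t ht => open_le_liminf hμ hμ₀ hv _ (hopen t ht)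
    _ ≤ atTop.liminf (fun n => ∫⁻ t in Ioi 0, μ n {x | t < f x}) :=
        lintegral_liminf_le fun n => Antitone.measurable fun s t hst =>
          measure_mono fun x hx => lt_of_le_of_lt hst hx
    _ ≤ atTop.liminf (fun _ : ℕ => c) := liminf_le_liminf (Eventually.of_forall hbd)
    _ = c := by simp

lemma eq_of_vague {μ ν : Measure X} (hμ : IsRadon μ) (hν : IsRadon ν)
    (h : ∀ f : X → ℝ, Continuous f → HasCompactSupport f → ∫ x, f x ∂μ = ∫ x, f x ∂ν) :
    μ = ν := by
  have : μ.Regular := hμ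
  have : ν.Regular := hν
  exact Measure.ext_of_integral_eq_on_compactlySupported
    fun f => h f f.continuous f.hasCompactSupport

lemma vague_of_strong (hR1 : R1 κ) {ι : Type*} {l : Filter ι} {m : ι → Measure X} {μ : Measure X}
    (hm : ∀ i, memE κ (m i)) (hμ : memE κ μ)
    (hs : Tendsto (fun i => sDist κ (m i) μ) l (𝓝 0)) (f : X → ℝ) (hf : Continuous f)
    (hfc : HasCompactSupport f) :
    Tendsto (fun i => ∫ z, f z ∂(m i)) l (𝓝 (∫ z, f z ∂μ)) := by
  by_contra hcon
  rw [Metric.tendsto_nhds] at hcon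
  push Not at hcon
  obtain ⟨ε, hε, hfr⟩ := hcon
  have hex : ∀ n : ℕ, ∃ i, sDist κ (m i) μ < 1 / ((n : ℝ) + 1) ∧
      ε ≤ dist (∫ z, f z ∂(m i)) (∫ z, f z ∂μ) := by
    intro n
    have h1 : ∀ᶠ i in l, sDist κ (m i) μ < 1 / ((n : ℝ) + 1) :=
      hs.eventually_lt_const (by positivity)
    obtain ⟨i, h2, h3⟩ := (hfr.and_eventually h1).exists
    exact ⟨i, h3, by simpa using h2⟩
  choose i hi1 hi2 using hex
  have hstr : Tendsto (fun n => sDist κ (m (i n)) μ) atTop (𝓝 0) :=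
    squeeze_zero (fun n => Real.sqrt_nonneg _) (fun n => (hi1 n).le)
      tendsto_one_div_add_atTop_nhds_zero_nat
  have hv := hR1.perfect.finerThanVague _ _ (fun n => hm (i n)) hμ hstr f hf hfc
  rw [Metric.tendsto_nhds] at hv
  obtain ⟨n, hn⟩ := (hv ε hε).exists
  exact absurd hn (not_lt.2 (hi2 n))

end Helpers

/-- As `K` ranges over the compact subsets of `A` directed by inclusion,
`ω^K → ω^A` strongly and vaguely, and `U^{ω^K} ↑ U^{ω^A}` pointwise; each of these three
limit relations determines `ω^A` uniquely within `E'(A)`. -/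
theorem inner_balayage_compact_approximation
    {X : Type*} [TopologicalSpace X] [T2Space X] [LocallyCompactSpace X]
    [SecondCountableTopology X] [MeasurableSpace X] [BorelSpace X]
    (κ : X → X → ℝ≥0∞) (hκ : IsKernel κ) (hR1 : R1 κ) (hR2 : R2 κ) (hR3 : R3 κ)
    (A : Set X) (hA : A ≠ Set.univ) (hcap : 0 < innerCap κ A)
    (ω : Measure X) (hωR : IsRadon ω) (hω0 : ω ≠ 0)
    (hfin : FiniteEnergy κ ω ∨ (ω A = 0 ∧ ω Set.univ < ⊤))
    (balK : Set X → Measure X)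
    (hbalK : ∀ K : Set X, IsCompact K → K ⊆ A →
      memEOn κ K (balK K) ∧
      innerCap κ {x ∈ K | potential κ (balK K) x ≠ potential κ ω x} = 0)
    (ωA : Measure X) (hωA : IsInnerBalayage κ A ω ωA) :
    Tendsto (fun K : {K : Set X // IsCompact K ∧ K ⊆ A} => sDist κ (balK K.1) ωA) atTop (nhds 0) ∧
    (∀ f : X → ℝ, Continuous f → HasCompactSupport f →
      Tendsto (fun K : {K : Set X // IsCompact K ∧ K ⊆ A} => ∫ z, f z ∂(balK K.1)) atTop (nhds (∫ z, f z ∂ωA))) ∧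
    (∀ x : X, Monotone (fun K : {K : Set X // IsCompact K ∧ K ⊆ A} => potential κ (balK K.1) x) ∧
      (⨆ K : {K : Set X // IsCompact K ∧ K ⊆ A}, potential κ (balK K.1) x) = potential κ ωA x) ∧
    (∀ μ : Measure X, memEClos κ A μ →
      Tendsto (fun K : {K : Set X // IsCompact K ∧ K ⊆ A} => sDist κ (balK K.1) μ) atTop (nhds 0) → μ = ωA) ∧
    (∀ μ : Measure X, memEClos κ A μ →
      (∀ f : X → ℝ, Continuous f → HasCompactSupport f →
        Tendsto (fun K : {K : Set X // IsCompact K ∧ K ⊆ A} => ∫ z, f z ∂(balK K.1)) atTop (nhds (∫ z, f z ∂μ))) →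
      μ = ωA) ∧
    (∀ μ : Measure X, memEClos κ A μ →
      (∀ x : X, (⨆ K : {K : Set X // IsCompact K ∧ K ⊆ A}, potential κ (balK K.1) x) = potential κ μ x) → μ = ωA) := by
  have hE : ∀ K : {K : Set X // IsCompact K ∧ K ⊆ A}, memE κ (balK K.1) :=
    fun K => (hbalK K.1 K.2.1 K.2.2).1.1
  have hAE : memE κ ωA := hωA.1.1
  -- a.e. equality of the potentials
  have hae : ∀ K : {K : Set X // IsCompact K ∧ K ⊆ A}, ∀ ν, memEOn κ K.1 ν →
      ∀ᵐ x ∂ν, potential κ (balK K.1) x = potential κ ωA x := by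
    intro K ν hν
    filter_upwards [ae_eq_of_ne hκ K.2.1 K.2.2 hAE.1 hωR hν hωA.2,
      ae_eq_of_ne hκ K.2.1 subset_rfl (hE K).1 hωR hν (hbalK K.1 K.2.1 K.2.2).2] with x h1 h2
    rw [h1, h2]
  have hle : ∀ K : {K : Set X // IsCompact K ∧ K ⊆ A}, ∀ x,
      potential κ (balK K.1) x ≤ potential κ ωA x := fun K =>
    hR1.domination _ _ (hE K) hAE.1
      ((hae K _ (hbalK K.1 K.2.1 K.2.2).1).mono fun x hx => hx.le)
  have hmono : ∀ K L : {K : Set X // IsCompact K ∧ K ⊆ A}, K ≤ L → ∀ x,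
      potential κ (balK K.1) x ≤ potential κ (balK L.1) x := by
    intro K L hKL
    have hKL' : K.1 ⊆ L.1 := hKL
    have hb := (hbalK K.1 K.2.1 K.2.2).1
    refine hR1.domination _ _ (hE K) (hE L).1 ?_
    filter_upwards [hae K _ hb, hae L _
      ⟨hb.1, measure_mono_null (compl_subset_compl.2 hKL') hb.2⟩] with x h1 h2
    rw [h1, h2]
  -- projection property
  have hen : ∀ K : {K : Set X // IsCompact K ∧ K ⊆ A}, ∀ ν, memEOn κ K.1 ν →
      energy κ ν (balK K.1) = energy κ ν ωA := fun K ν hν => lintegral_congr_ae (hae K ν hν)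
  have hproj : ∀ K : {K : Set X // IsCompact K ∧ K ⊆ A}, ∀ ν, memEOn κ K.1 ν →
      (energy κ (balK K.1) (balK K.1)).toReal + (energy κ ωA ωA).toReal
        - 2 * (energy κ (balK K.1) ωA).toReal ≤
      (energy κ ωA ωA).toReal + (energy κ ν ν).toReal - 2 * (energy κ ν ωA).toReal := by
    intro K ν hν
    rw [← hen K ν hν, ← hen K _ (hbalK K.1 K.2.1 K.2.2).1]
    have h := (hR1.perfect.posdef ν (balK K.1) hν.1.1 (hE K).1 hν.1.2 (hE K).2).1
    have h2 := ENNReal.toReal_mono (ENNReal.add_ne_top.2 ⟨hν.1.2.ne, (hE K).2.ne⟩) h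
    rw [ENNReal.toReal_add hν.1.2.ne (hE K).2.ne, ENNReal.toReal_mul] at h2
    simp only [ENNReal.toReal_ofNat] at h2
    linarith
  have hstrong : Tendsto (fun K : {K : Set X // IsCompact K ∧ K ⊆ A} => sDist κ (balK K.1) ωA)
      atTop (nhds 0) := by
    rw [Metric.tendsto_nhds]
    intro ε hε
    obtain ⟨ν, hν, hd⟩ := hωA.1.2 ε hε
    unfold sDist at hd
    rw [Real.sqrt_lt' hε, energy_comm hκ hAE.1 hν.1.1] at hd
    obtain ⟨K, hK, hKA, hKe⟩ := exists_compact_approx hκ hR1 hAE hν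
      (δ := (ε ^ 2 - ((energy κ ωA ωA).toReal + (energy κ ν ν).toReal
        - 2 * (energy κ ν ωA).toReal)) / 2) (by linarith)
    filter_upwards [eventually_ge_atTop (⟨K, hK, hKA⟩ : {K : Set X // IsCompact K ∧ K ⊆ A})]
      with L hL
    have hKL : K ⊆ L.1 := hL
    have hr : memEOn κ L.1 (ν.restrict K) := by
      refine ⟨restrict_memE hν.1 K, measure_mono_null (compl_subset_compl.2 hKL) ?_⟩
      simp [Measure.restrict_apply hK.measurableSet.compl]
    have hp := hproj L _ hr
    have hrle : (energy κ (ν.restrict K) (ν.restrict K)).toReal ≤ (energy κ ν ν).toReal :=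
      ENNReal.toReal_mono hν.1.2.ne (restrict_mono_energy ν _ K Measure.restrict_le_self)
    rw [Real.dist_eq, sub_zero, abs_of_nonneg (show 0 ≤ sDist κ (balK L.1) ωA from Real.sqrt_nonneg _)]
    unfold sDist
    rw [Real.sqrt_lt' hε]
    linarith
  have hvague := vague_of_strong hR1 hE hAE hstrong
  have : Nonempty {K : Set X // IsCompact K ∧ K ⊆ A} := ⟨⟨∅, isCompact_empty, empty_subset _⟩⟩
  have : IsDirected {K : Set X // IsCompact K ∧ K ⊆ A} (· ≤ ·) :=
    ⟨fun K L => ⟨⟨K.1 ∪ L.1, K.2.1.union L.2.1, union_subset K.2.2 L.2.2⟩,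
      (subset_union_left : K.1 ⊆ K.1 ∪ L.1), (subset_union_right : L.1 ⊆ K.1 ∪ L.1)⟩⟩
  have hsup : ∀ x, (⨆ K : {K : Set X // IsCompact K ∧ K ⊆ A}, potential κ (balK K.1) x)
      = potential κ ωA x := by
    intro x
    refine le_antisymm (iSup_le fun K => hle K x) ?_
    have hex : ∀ n : ℕ, ∃ K : {K : Set X // IsCompact K ∧ K ⊆ A},
        sDist κ (balK K.1) ωA < 1 / ((n : ℝ) + 1) := fun n =>
      (hstrong.eventually_lt_const (by positivity)).exists
    choose k hk using hex
    have hstr : Tendsto (fun n => sDist κ (balK (k n).1) ωA) atTop (𝓝 0) :=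
      squeeze_zero (fun n => Real.sqrt_nonneg _) (fun n => (hk n).le)
        tendsto_one_div_add_atTop_nhds_zero_nat
    have hv := hR1.perfect.finerThanVague _ _ (fun n => hE (k n)) hAE hstr
    have hlsc : LowerSemicontinuous (κ x) :=
      LowerSemicontinuous.comp (f := fun p : X × X => κ p.1 p.2) (g := fun y => (x, y)) hκ.lsc
        (Continuous.prodMk_right x)
    exact lintegral_lsc_le_of_vague (fun n => (hE (k n)).1) hAE.1 hv hlsc
      fun n => le_iSup (fun K : {K : Set X // IsCompact K ∧ K ⊆ A} => potential κ (balK K.1) x) (k n)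
  have huniq : ∀ μ : Measure X, memEClos κ A μ →
      (∀ f : X → ℝ, Continuous f → HasCompactSupport f →
        Tendsto (fun K : {K : Set X // IsCompact K ∧ K ⊆ A} => ∫ z, f z ∂(balK K.1)) atTop
          (nhds (∫ z, f z ∂μ))) → μ = ωA := fun μ hμ h =>
    eq_of_vague hμ.1.1 hAE.1 fun f hf hfc => tendsto_nhds_unique (h f hf hfc) (hvague f hf hfc)
  refine ⟨hstrong, hvague, fun x => ⟨fun K L hKL => hmono K L hKL x, hsup x⟩,
    fun μ hμ h => huniq μ hμ (vague_of_strong hR1 hE hμ.1 h), huniq, fun μ hμ h => ?_⟩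
  have hpot : potential κ μ = potential κ ωA := funext fun x => by rw [← h x, hsup x]
  refine (hR1.perfect.posdef μ ωA hμ.1.1 hAE.1 hμ.1.2 hAE.2).2 ?_
  have h1 : energy κ μ ωA = energy κ μ μ := by unfold energy; rw [hpot]
  have h2 : energy κ ωA ωA = energy κ μ ωA := by
    rw [energy_comm hκ hμ.1.1 hAE.1]; unfold energy; rw [hpot]
  rw [h2, h1, two_mul]

end Balayage
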